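/- arXiv:2603.22351 — 2 statements merged into one kernel-verified Lean document; each statement's English description precedes it below -/
import Mathlib

section
/- Let l be a closed polygonal line and p an open polygonal line in the plane with initial point P₀ and terminal point P₁, such that the vertices of l together with the vertices of p are pairwise distinct and in general position, and assume moreover that P₀ does not lie in the convex hull of the vertices of l. Then w(l, P₁) = l · p, where l · p is the sum, over all pairs consisting of an oriented edge \vec{AB} of l and an oriented edge \vec{CD} of p whose underlying segments intersect, of the sign of that intersection point. -/
/-- The oriented angle `∠AOB ∈ (−π, π]` with vertex `O`. -/
noncomputable def oangle (O A B : ℂ) : ℝ := Complex.arg ((B - O) / (A - O))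

/-- The cross product `det(z, w)` of two plane vectors. -/
def cross (z w : ℂ) : ℝ := z.re * w.im - z.im * w.re

/-- The cyclic (oriented) edges of a closed polygonal line given by its list of vertices. -/
def cyc (l : List ℂ) : List (ℂ × ℂ) := l.zip (l.rotate 1)

/-- The (oriented) edges of an open polygonal line given by its list of vertices. -/
def opairs (l : List ℂ) : List (ℂ × ℂ) := l.zip l.tail

/-- The winding number of a closed polygonal line around `O`. -/
noncomputable def wind (l : List ℂ) (O : ℂ) : ℝ :=
  ((cyc l).map (fun e => oangle O e.1 e.2)).sum / (2 * Real.pi)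

open scoped Classical in
/-- The contribution of a pair of oriented edges `e`, `f` to the signed intersection
number: `0` if the underlying segments do not intersect, and otherwise the sign of the
intersection point (`+1` if the traversal `e.1 e.2 f.1` is clockwise, `−1` otherwise). -/
noncomputable def isect (e f : ℂ × ℂ) : ℝ :=
  if (segment ℝ e.1 e.2 ∩ segment ℝ f.1 f.2).Nonempty then
    (if cross (e.2 - e.1) (f.1 - e.1) < 0 then 1 else -1)
  else 0

/-- The sum of the signs of the intersection points over all pairs of oriented edges. -/
noncomputable def signedSum (L P : List (ℂ × ℂ)) : ℝ :=
  (L.map (fun e => (P.map (fun f => isect e f)).sum)).sum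

/-- A finite collection of points is in general position if the points are pairwise distinct,
no three of them lie on a common line, and no three of the segments joining pairs of them
have a common interior point. -/
def GenPos (pts : List ℂ) : Prop :=
  pts.Pairwise (· ≠ ·) ∧
  (∀ a ∈ pts, ∀ b ∈ pts, ∀ c ∈ pts, a ≠ b → a ≠ c → b ≠ c →
    ¬ Collinear ℝ ({a, b, c} : Set ℂ)) ∧
  (∀ a₁ ∈ pts, ∀ b₁ ∈ pts, ∀ a₂ ∈ pts, ∀ b₂ ∈ pts, ∀ a₃ ∈ pts, ∀ b₃ ∈ pts,
    ({a₁, b₁} : Set ℂ) ≠ {a₂, b₂} → ({a₁, b₁} : Set ℂ) ≠ {a₃, b₃} →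
    ({a₂, b₂} : Set ℂ) ≠ {a₃, b₃} →
    ¬ ∃ x, x ∈ openSegment ℝ a₁ b₁ ∧ x ∈ openSegment ℝ a₂ b₂ ∧ x ∈ openSegment ℝ a₃ b₃)

theorem oangle_pos {O A B : ℂ} (h : 0 < cross (A - O) (B - O)) : 0 < oangle O A B := by
  have hA : A - O ≠ 0 := by
    intro h0
    simp [h0, cross] at h
  have him : 0 < ((B - O) / (A - O)).im := by
    have : ((B - O) / (A - O)).im = cross (A - O) (B - O) / Complex.normSq (A - O) := by
      rw [Complex.div_im, cross]
      ring
    rw [this]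
    exact div_pos h (Complex.normSq_pos.mpr hA)
  refine lt_of_le_of_ne (Complex.arg_nonneg_iff.mpr him.le) fun h0 => ?_
  exact him.ne' (Complex.arg_eq_zero_iff.mp h0.symm).2

theorem oangle_lt_pi {O A B : ℂ} (h : cross (A - O) (B - O) ≠ 0) : oangle O A B < Real.pi := by
  refine lt_of_le_of_ne (Complex.arg_le_pi _) fun h0 => h ?_
  have hA : A - O ≠ 0 := by
    intro h0
    simp [h0, cross] at h
  have him := (Complex.arg_eq_pi_iff.mp h0).2
  have : ((B - O) / (A - O)).im = cross (A - O) (B - O) / Complex.normSq (A - O) := by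
    rw [Complex.div_im, cross]
    ring
  rw [this, div_eq_zero_iff] at him
  exact him.resolve_right (Complex.normSq_pos.mpr hA).ne'

theorem oangle_swap {O A B : ℂ} (h : cross (A - O) (B - O) ≠ 0) :
    oangle O B A = -oangle O A B := by
  have hne : Complex.arg ((B - O) / (A - O)) ≠ Real.pi := (oangle_lt_pi h).ne
  rw [oangle, ← inv_div, Complex.arg_inv, if_neg hne, oangle]

theorem oangle_neg {O A B : ℂ} (h : cross (A - O) (B - O) < 0) : oangle O A B < 0 := by
  have h' : 0 < cross (B - O) (A - O) := by
    simp only [cross] at *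
    linarith
  have := oangle_pos h'
  rw [oangle_swap h.ne] at this
  linarith

theorem oangle_neg_pi_lt (O A B : ℂ) : -Real.pi < oangle O A B := Complex.neg_pi_lt_arg _

theorem coe_oangle {O A B : ℂ} (hA : A ≠ O) (hB : B ≠ O) :
    (oangle O A B : Real.Angle) =
      (Complex.arg (B - O) : Real.Angle) - (Complex.arg (A - O) : Real.Angle) :=
  Complex.arg_div_coe_angle (sub_ne_zero.mpr hB) (sub_ne_zero.mpr hA)

theorem coe_arg_sub_comm {A B : ℂ} (h : A ≠ B) :
    (Complex.arg (A - B) : Real.Angle) = (Complex.arg (B - A) : Real.Angle) + (Real.pi : ℝ) := by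
  rw [← neg_sub B A, Complex.arg_neg_coe_angle (sub_ne_zero.mpr h.symm)]

theorem exists_int_of_coe_eq {x y : ℝ} (h : (x : Real.Angle) = y) :
    ∃ n : ℤ, x - y = 2 * Real.pi * n :=
  Real.Angle.angle_eq_iff_two_pi_dvd_sub.mp h

theorem eq_of_coe_eq_of_abs_sub_lt {x y : ℝ} (h : (x : Real.Angle) = y)
    (h₁ : x - y < 2 * Real.pi) (h₂ : -(2 * Real.pi) < x - y) : x = y := by
  obtain ⟨n, hn⟩ := exists_int_of_coe_eq h
  have hpi := Real.pi_pos
  rw [hn] at h₁ h₂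
  have h₃ : (n : ℝ) < 1 := by nlinarith
  have h₄ : (-1 : ℝ) < n := by nlinarith
  have h₅ : n = 0 := by
    have : n < 1 := by exact_mod_cast h₃
    have : -1 < n := by exact_mod_cast h₄
    omega
  rw [h₅] at hn
  simp at hn
  linarith

theorem ne_of_cross_ne_zero {O A B : ℂ} (h : cross (A - O) (B - O) ≠ 0) :
    A ≠ O ∧ B ≠ O ∧ A ≠ B := by
  refine ⟨?_, ?_, ?_⟩ <;> rintro rfl <;> simp [cross, mul_comm] at h

theorem oangle_triangle {X Y Z : ℂ} (h : 0 < cross (Y - X) (Z - X)) :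
    oangle X Y Z + oangle Y Z X + oangle Z X Y = Real.pi := by
  have hY : 0 < cross (Z - Y) (X - Y) := by
    simp only [cross, Complex.sub_re, Complex.sub_im] at *
    linarith
  have hZ : 0 < cross (X - Z) (Y - Z) := by
    simp only [cross, Complex.sub_re, Complex.sub_im] at *
    linarith
  obtain ⟨n₁, n₂, n₃⟩ := ne_of_cross_ne_zero h.ne'
  have p₁ := oangle_pos h
  have p₂ := oangle_pos hY
  have p₃ := oangle_pos hZ
  have q₁ := oangle_lt_pi h.ne'
  have q₂ := oangle_lt_pi hY.ne'
  have q₃ := oangle_lt_pi hZ.ne'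
  refine eq_of_coe_eq_of_abs_sub_lt ?_ (by linarith) (by linarith)
  rw [Real.Angle.coe_add, Real.Angle.coe_add, coe_oangle n₁ n₂, coe_oangle n₃.symm n₁.symm,
    coe_oangle n₂.symm n₃, coe_arg_sub_comm n₁, coe_arg_sub_comm n₂, coe_arg_sub_comm n₃.symm]
  have := Real.Angle.coe_pi_add_coe_pi
  generalize (Real.pi : Real.Angle) = t at *
  have h2 : -t = t := (eq_neg_of_add_eq_zero_left this).symm
  abel_nf
  simpa using h2

/-- The sum of the oriented angles of the quadrilateral `W X Y Z`, each in `(-π, π]`. -/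
noncomputable def quadSum (W X Y Z : ℂ) : ℝ :=
  oangle W X Z + oangle X Y W + oangle Y Z X + oangle Z W Y

theorem quadSum_rotate (W X Y Z : ℂ) : quadSum X Y Z W = quadSum W X Y Z := by
  simp only [quadSum]
  ring

theorem coe_quadSum {W X Y Z : ℂ} (h₁ : W ≠ X) (h₂ : X ≠ Y) (h₃ : Y ≠ Z) (h₄ : Z ≠ W) :
    (quadSum W X Y Z : Real.Angle) = ((0 : ℝ) : Real.Angle) := by
  rw [quadSum, Real.Angle.coe_add, Real.Angle.coe_add, Real.Angle.coe_add, coe_oangle h₁.symm h₄,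
    coe_oangle h₂.symm h₁, coe_oangle h₃.symm h₂, coe_oangle h₄.symm h₃, coe_arg_sub_comm h₁,
    coe_arg_sub_comm h₂, coe_arg_sub_comm h₃, coe_arg_sub_comm h₄, Real.Angle.coe_zero]
  have := Real.Angle.coe_pi_add_coe_pi
  generalize (Real.pi : Real.Angle) = t at *
  have h4 : (4 : ℤ) • t = 0 := by
    rw [show (4 : ℤ) = 2 * 2 from rfl, mul_zsmul, two_zsmul t, this, zsmul_zero]
  abel_nf
  exact h4

/-- A quadrilateral with exactly one clockwise corner, located at `Z`. -/
theorem quadSum_eq_zero_of_reflex {W X Y Z : ℂ} (hW : 0 < cross (X - W) (Z - W))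
    (hX : 0 < cross (Y - X) (W - X)) (hY : 0 < cross (Z - Y) (X - Y))
    (hZ : cross (W - Z) (Y - Z) < 0) : quadSum W X Y Z = 0 := by
  have tW := oangle_triangle hW
  have tY := oangle_triangle hY
  have hX₁ : 0 < cross (Y - X) (Z - X) := by
    simp only [cross, Complex.sub_re, Complex.sub_im] at *
    linarith
  have hX₂ : 0 < cross (Z - X) (W - X) := by
    simp only [cross, Complex.sub_re, Complex.sub_im] at *
    linarith
  have hZ₁ : 0 < cross (W - Z) (X - Z) := by
    simp only [cross, Complex.sub_re, Complex.sub_im] at *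
    linarith
  have hZ₂ : 0 < cross (X - Z) (Y - Z) := by
    simp only [cross, Complex.sub_re, Complex.sub_im] at *
    linarith
  obtain ⟨n₁, n₂, -⟩ := ne_of_cross_ne_zero hX.ne'
  obtain ⟨n₃, n₄, -⟩ := ne_of_cross_ne_zero hZ.ne
  obtain ⟨-, n₅, -⟩ := ne_of_cross_ne_zero hX₁.ne'
  have p₁ := oangle_pos hX₁
  have p₂ := oangle_pos hX₂
  have p₃ := oangle_pos hZ₁
  have p₄ := oangle_pos hZ₂
  have pW := oangle_pos hW
  have pX := oangle_pos hX
  have pY := oangle_pos hY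
  have pZ := oangle_neg hZ
  have pZ' := oangle_neg_pi_lt Z W Y
  have q₁ := oangle_lt_pi hX₁.ne'
  have q₂ := oangle_lt_pi hX₂.ne'
  have qX := oangle_lt_pi hX.ne'
  have split : oangle X Y Z + oangle X Z W = oangle X Y W := by
    refine eq_of_coe_eq_of_abs_sub_lt ?_ (by linarith) (by linarith)
    rw [Real.Angle.coe_add, coe_oangle n₁ n₅, coe_oangle n₅ n₂, coe_oangle n₁ n₂]
    abel
  refine eq_of_coe_eq_of_abs_sub_lt (coe_quadSum n₂ n₁.symm n₄ n₃.symm) ?_ ?_ <;>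
    simp only [quadSum] <;> linarith

theorem quadSum_eq_two_pi {W X Y Z : ℂ} (hW : 0 < cross (X - W) (Z - W))
    (hX : 0 < cross (Y - X) (W - X)) (hY : 0 < cross (Z - Y) (X - Y))
    (hZ : 0 < cross (W - Z) (Y - Z)) : quadSum W X Y Z = 2 * Real.pi := by
  obtain ⟨n₁, n₂, -⟩ := ne_of_cross_ne_zero hX.ne'
  obtain ⟨n₃, n₄, -⟩ := ne_of_cross_ne_zero hZ.ne'
  have pW := oangle_pos hW
  have pX := oangle_pos hX
  have pY := oangle_pos hY
  have pZ := oangle_pos hZ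
  have qW := oangle_lt_pi hW.ne'
  have qX := oangle_lt_pi hX.ne'
  have qY := oangle_lt_pi hY.ne'
  have qZ := oangle_lt_pi hZ.ne'
  refine eq_of_coe_eq_of_abs_sub_lt ?_ ?_ ?_
  · rw [coe_quadSum n₂ n₁.symm n₄ n₃.symm]
    simp
  all_goals simp only [quadSum]; linarith

theorem quadSum_reverse {W X Y Z : ℂ} (hW : cross (X - W) (Z - W) ≠ 0)
    (hX : cross (Y - X) (W - X) ≠ 0) (hY : cross (Z - Y) (X - Y) ≠ 0)
    (hZ : cross (W - Z) (Y - Z) ≠ 0) : quadSum W Z Y X = -quadSum W X Y Z := by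
  simp only [quadSum]
  rw [oangle_swap hW, oangle_swap hX, oangle_swap hY, oangle_swap hZ]
  ring

theorem cross_swap (z w : ℂ) : cross w z = -cross z w := by
  simp only [cross]
  ring

/-- A quadrilateral with at least one counterclockwise corner, at `W`, and at least one
clockwise corner. -/
theorem quadSum_eq_zero_of_pos {W X Y Z : ℂ} (hW : 0 < cross (X - W) (Z - W))
    (hX : cross (Y - X) (W - X) ≠ 0) (hY : cross (Z - Y) (X - Y) ≠ 0)
    (hZ : cross (W - Z) (Y - Z) ≠ 0)
    (h : cross (Y - X) (W - X) < 0 ∨ cross (Z - Y) (X - Y) < 0 ∨ cross (W - Z) (Y - Z) < 0) :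
    quadSum W X Y Z = 0 := by
  obtain ⟨n₁, n₂, -⟩ := ne_of_cross_ne_zero hX
  obtain ⟨n₃, n₄, -⟩ := ne_of_cross_ne_zero hZ
  have hc := coe_quadSum n₂ n₁.symm n₄ n₃.symm
  have pW := oangle_pos hW
  have qW := oangle_lt_pi hW.ne'
  have rX := oangle_neg_pi_lt X Y W
  have rY := oangle_neg_pi_lt Y Z X
  have rZ := oangle_neg_pi_lt Z W Y
  have qX := oangle_lt_pi hX
  have qY := oangle_lt_pi hY
  have qZ := oangle_lt_pi hZ
  rcases lt_or_gt_of_ne hX with hX' | hX' <;> rcases lt_or_gt_of_ne hY with hY' | hY' <;>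
    rcases lt_or_gt_of_ne hZ with hZ' | hZ'
  · have := quadSum_eq_zero_of_reflex (W := Z) (X := Y) (Y := X) (Z := W)
      (by rw [cross_swap]; linarith) (by rw [cross_swap]; linarith)
      (by rw [cross_swap]; linarith) (by rw [cross_swap]; linarith)
    rw [quadSum_rotate, quadSum_reverse hW.ne' hX hY hZ] at this
    linarith
  · have pX := oangle_neg hX'
    have pY := oangle_neg hY'
    exact eq_of_coe_eq_of_abs_sub_lt hc (by simp only [quadSum]; linarith [oangle_pos hZ'])
      (by simp only [quadSum]; linarith [oangle_pos hZ'])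
  · exact eq_of_coe_eq_of_abs_sub_lt hc
      (by simp only [quadSum]; linarith [oangle_neg hX', oangle_pos hY', oangle_neg hZ'])
      (by simp only [quadSum]; linarith [oangle_neg hX', oangle_pos hY', oangle_neg hZ'])
  · rw [← quadSum_rotate, ← quadSum_rotate]
    exact quadSum_eq_zero_of_reflex hY' hZ' hW hX'
  · exact eq_of_coe_eq_of_abs_sub_lt hc
      (by simp only [quadSum]; linarith [oangle_pos hX', oangle_neg hY', oangle_neg hZ'])
      (by simp only [quadSum]; linarith [oangle_pos hX', oangle_neg hY', oangle_neg hZ'])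
  · rw [← quadSum_rotate, ← quadSum_rotate, ← quadSum_rotate]
    exact quadSum_eq_zero_of_reflex hZ' hW hX' hY'
  · exact quadSum_eq_zero_of_reflex hW hX' hY' hZ'
  · rcases h with h | h | h <;> linarith

theorem quadSum_eq_zero {W X Y Z : ℂ} (hW : cross (X - W) (Z - W) ≠ 0)
    (hX : cross (Y - X) (W - X) ≠ 0) (hY : cross (Z - Y) (X - Y) ≠ 0)
    (hZ : cross (W - Z) (Y - Z) ≠ 0)
    (hpos : ¬(0 < cross (X - W) (Z - W) ∧ 0 < cross (Y - X) (W - X) ∧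
      0 < cross (Z - Y) (X - Y) ∧ 0 < cross (W - Z) (Y - Z)))
    (hneg : ¬(cross (X - W) (Z - W) < 0 ∧ cross (Y - X) (W - X) < 0 ∧
      cross (Z - Y) (X - Y) < 0 ∧ cross (W - Z) (Y - Z) < 0)) :
    quadSum W X Y Z = 0 := by
  rcases lt_or_gt_of_ne hW with hW' | hW'
  · have := quadSum_eq_zero_of_pos (W := W) (X := Z) (Y := Y) (Z := X)
      (by rw [cross_swap]; linarith) (by rwa [cross_swap, neg_ne_zero])
      (by rwa [cross_swap, neg_ne_zero]) (by rwa [cross_swap, neg_ne_zero])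
      (by
        rw [cross_swap (W - Z), cross_swap (Z - Y), cross_swap (Y - X)]
        by_contra hcon
        push Not at hcon
        obtain ⟨c₁, c₂, c₃⟩ := hcon
        exact hneg ⟨hW', lt_of_le_of_ne (by linarith) hX, lt_of_le_of_ne (by linarith) hY,
          lt_of_le_of_ne (by linarith) hZ⟩)
    rw [quadSum_reverse hW hX hY hZ] at this
    linarith
  · refine quadSum_eq_zero_of_pos hW' hX hY hZ ?_
    by_contra hcon
    push Not at hcon
    obtain ⟨c₁, c₂, c₃⟩ := hcon
    exact hpos ⟨hW', lt_of_le_of_ne c₁ hX.symm, lt_of_le_of_ne c₂ hY.symm,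
      lt_of_le_of_ne c₃ hZ.symm⟩

theorem collinear_of_cross_eq_zero {O A B : ℂ} (h : cross (A - O) (B - O) = 0) :
    Collinear ℝ ({O, A, B} : Set ℂ) := by
  by_cases hA : A = O
  · subst hA
    simpa using collinear_pair ℝ A B
  have hn : Complex.normSq (A - O) ≠ 0 := (Complex.normSq_pos.mpr (sub_ne_zero.mpr hA)).ne'
  rw [collinear_iff_of_mem (p₀ := O) (by simp)]
  refine ⟨A - O, ?_⟩
  rintro x (rfl | rfl | rfl)
  · exact ⟨0, by simp⟩
  · exact ⟨1, by simp⟩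
  · refine ⟨((A - O).re * (x - O).re + (A - O).im * (x - O).im) / Complex.normSq (A - O), ?_⟩
    have key : x - O = (((A - O).re * (x - O).re + (A - O).im * (x - O).im) /
        Complex.normSq (A - O)) • (A - O) := by
      rw [Complex.normSq_apply, ← sq, ← sq] at hn ⊢
      rw [cross] at h
      generalize A - O = u at *
      generalize x - O = v at *
      apply Complex.ext
      · rw [Complex.smul_re, smul_eq_mul]
        field_simp
        linear_combination -u.im * h
      · rw [Complex.smul_im, smul_eq_mul]
        field_simp
        linear_combination u.re * h
    rw [vadd_eq_add, ← key]
    ring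

theorem mem_segment_iff_exists {x a b : ℂ} :
    x ∈ segment ℝ a b ↔ ∃ t : ℝ, 0 ≤ t ∧ t ≤ 1 ∧
      x.re = a.re + t * (b.re - a.re) ∧ x.im = a.im + t * (b.im - a.im) := by
  rw [segment_eq_image']
  constructor
  · rintro ⟨t, ⟨h₀, h₁⟩, rfl⟩
    exact ⟨t, h₀, h₁, by simp, by simp⟩
  · rintro ⟨t, h₀, h₁, hr, hi⟩
    exact ⟨t, ⟨h₀, h₁⟩, Complex.ext (by simp [hr]) (by simp [hi])⟩

theorem cross_eq_zero_of_mem_segment {x a b : ℂ} (h : x ∈ segment ℝ a b) :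
    cross (b - a) (x - a) = 0 := by
  obtain ⟨t, -, -, hr, hi⟩ := mem_segment_iff_exists.mp h
  simp only [cross, Complex.sub_re, Complex.sub_im, hr, hi]
  ring

/-- Two segments that meet, no three of whose endpoints are collinear, straddle each other. -/
theorem cross_mul_neg_of_inter {A B C D : ℂ}
    (hC : cross (B - A) (C - A) ≠ 0) (hD : cross (B - A) (D - A) ≠ 0)
    (h : (segment ℝ A B ∩ segment ℝ C D).Nonempty) :
    cross (B - A) (C - A) * cross (B - A) (D - A) < 0 := by
  obtain ⟨x, hx, hx'⟩ := h
  have h0 := cross_eq_zero_of_mem_segment hx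
  obtain ⟨t, t₀, t₁, hr, hi⟩ := mem_segment_iff_exists.mp hx'
  have e : (1 - t) * cross (B - A) (C - A) + t * cross (B - A) (D - A) = 0 := by
    simp only [cross, Complex.sub_re, Complex.sub_im, hr, hi] at *
    linear_combination h0
  generalize cross (B - A) (C - A) = u at *
  generalize cross (B - A) (D - A) = v at *
  by_contra! hcon
  have huv : 0 < u * v := lt_of_le_of_ne hcon (mul_ne_zero hC hD).symm
  have hu : 0 < u ^ 2 := by positivity
  have hv : 0 < v ^ 2 := by positivity
  have e₁ : (1 - t) * u ^ 2 + t * (u * v) = 0 := by linear_combination u * e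
  rcases eq_or_lt_of_le t₀ with ht | ht
  · rw [← ht] at e₁
    linarith
  · have : 0 < t * (u * v) := mul_pos ht huv
    have : 0 ≤ (1 - t) * u ^ 2 := mul_nonneg (by linarith) hu.le
    linarith

/-- Segments that straddle each other meet. -/
theorem inter_of_cross_mul_neg {A B C D : ℂ}
    (h₁ : cross (B - A) (C - A) * cross (B - A) (D - A) < 0)
    (h₂ : cross (D - C) (A - C) * cross (D - C) (B - C) < 0) :
    (segment ℝ A B ∩ segment ℝ C D).Nonempty := by
  have param : ∀ u v : ℝ, u * v < 0 → 0 ≤ u / (u - v) ∧ u / (u - v) ≤ 1 ∧ u - v ≠ 0 := by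
    intro u v huv
    rcases mul_neg_iff.mp huv with ⟨hu, hv⟩ | ⟨hu, hv⟩
    · have : 0 < u - v := by linarith
      exact ⟨by positivity, (div_le_one this).mpr (by linarith), this.ne'⟩
    · have : u - v < 0 := by linarith
      exact ⟨div_nonneg_of_nonpos hu.le this.le, (div_le_one_of_neg this).mpr (by linarith),
        this.ne⟩
  obtain ⟨s₀, s₁, hs⟩ := param _ _ h₁
  obtain ⟨t₀, t₁, ht⟩ := param _ _ h₂
  set t := cross (D - C) (A - C) / (cross (D - C) (A - C) - cross (D - C) (B - C)) with t_def
  set s := cross (B - A) (C - A) / (cross (B - A) (C - A) - cross (B - A) (D - A)) with s_def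
  refine ⟨A + t • (B - A), mem_segment_iff_exists.mpr ⟨t, t₀, t₁, by simp, by simp⟩,
    mem_segment_iff_exists.mpr ⟨s, s₀, s₁, ?_, ?_⟩⟩
  · simp only [Complex.add_re, Complex.real_smul, Complex.re_ofReal_mul, Complex.sub_re]
    rw [t_def, s_def]
    field_simp
    simp only [cross, Complex.sub_re, Complex.sub_im]
    ring
  · simp only [Complex.add_im, Complex.real_smul, Complex.im_ofReal_mul, Complex.sub_im]
    rw [t_def, s_def]
    field_simp
    simp only [cross, Complex.sub_re, Complex.sub_im]
    ring

theorem two_pi_mul_isect {A B C D : ℂ} (hABC : cross (B - A) (C - A) ≠ 0)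
    (hABD : cross (B - A) (D - A) ≠ 0) (hCDA : cross (D - C) (A - C) ≠ 0)
    (hCDB : cross (D - C) (B - C) ≠ 0) :
    2 * Real.pi * isect (A, B) (C, D) =
      oangle D A B - oangle C A B + (oangle A C D - oangle B C D) := by
  have eD : cross (A - D) (B - D) = cross (B - A) (D - A) := by
    simp only [cross, Complex.sub_re, Complex.sub_im]
    ring
  have eC : cross (B - C) (A - C) = -cross (B - A) (C - A) := by
    simp only [cross, Complex.sub_re, Complex.sub_im]
    ring
  have eA : cross (C - A) (D - A) = cross (D - C) (A - C) := by
    simp only [cross, Complex.sub_re, Complex.sub_im]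
    ring
  have eB : cross (D - B) (C - B) = -cross (D - C) (B - C) := by
    simp only [cross, Complex.sub_re, Complex.sub_im]
    ring
  have area : cross (B - A) (D - A) - cross (B - A) (C - A) =
      cross (D - C) (A - C) - cross (D - C) (B - C) := by
    simp only [cross, Complex.sub_re, Complex.sub_im]
    ring
  have hC : cross (B - C) (A - C) ≠ 0 := by rwa [eC, neg_ne_zero]
  have hB : cross (D - B) (C - B) ≠ 0 := by rwa [eB, neg_ne_zero]
  have hD : cross (A - D) (B - D) ≠ 0 := by rwa [eD]
  have hA : cross (C - A) (D - A) ≠ 0 := by rwa [eA]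
  have hsum : oangle D A B - oangle C A B + (oangle A C D - oangle B C D) = quadSum A C B D := by
    rw [quadSum, oangle_swap hC, oangle_swap hB]
    ring
  rw [hsum, isect]
  dsimp only
  split_ifs with hi hs
  · have h₁ := cross_mul_neg_of_inter hABC hABD hi
    have h₂ := cross_mul_neg_of_inter hCDA hCDB (by rwa [Set.inter_comm])
    have i₁ : 0 < cross (B - A) (D - A) := pos_of_mul_neg_right h₁ hs.le
    have i₂ : cross (D - C) (B - C) < 0 ∧ 0 < cross (D - C) (A - C) := by
      rcases mul_neg_iff.mp h₂ with h | h
      · exact h.symm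
      · linarith
    rw [quadSum_eq_two_pi (by rw [eA]; exact i₂.2) (by rw [eC]; linarith)
      (by rw [eB]; linarith) (by rw [eD]; exact i₁)]
    ring
  · have hs' : 0 < cross (B - A) (C - A) := lt_of_le_of_ne (not_lt.mp hs) hABC.symm
    have h₁ := cross_mul_neg_of_inter hABC hABD hi
    have h₂ := cross_mul_neg_of_inter hCDA hCDB (by rwa [Set.inter_comm])
    have i₁ : cross (B - A) (D - A) < 0 := neg_of_mul_neg_right h₁ hs'.le
    have i₂ : 0 < cross (D - C) (B - C) ∧ cross (D - C) (A - C) < 0 := by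
      rcases mul_neg_iff.mp h₂ with h | h
      · linarith
      · exact h.symm
    have := quadSum_eq_two_pi (W := A) (X := D) (Y := B) (Z := C)
      (by rw [cross_swap, eA]; linarith) (by rw [cross_swap, eD]; linarith)
      (by rw [cross_swap, eB]; linarith) (by rw [cross_swap, eC]; linarith)
    rw [quadSum_reverse hA hC hB hD] at this
    linarith
  · rw [mul_zero, quadSum_eq_zero hA hC hB hD]
    · rintro ⟨a, c, b, d⟩
      rw [eA] at a
      rw [eB] at b
      rw [eC] at c
      rw [eD] at d
      exact hi (inter_of_cross_mul_neg (mul_neg_of_neg_of_pos (by linarith) d)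
        (mul_neg_of_pos_of_neg a (by linarith)))
    · rintro ⟨a, c, b, d⟩
      rw [eA] at a
      rw [eB] at b
      rw [eC] at c
      rw [eD] at d
      exact hi (inter_of_cross_mul_neg (mul_neg_of_pos_of_neg (by linarith) d)
        (mul_neg_of_neg_of_pos a (by linarith)))

theorem GenPos.cross_ne_zero {pts : List ℂ} (h : GenPos pts) {O A B : ℂ} (hO : O ∈ pts)
    (hA : A ∈ pts) (hB : B ∈ pts) (hOA : O ≠ A) (hOB : O ≠ B) (hAB : A ≠ B) :
    cross (A - O) (B - O) ≠ 0 :=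
  fun h0 => h.2.1 O hO A hA B hB hOA hOB hAB (collinear_of_cross_eq_zero h0)

theorem oangle_self {O A : ℂ} (h : A ≠ O) : oangle O A A = 0 := by
  rw [oangle, div_self (sub_ne_zero.mpr h), Complex.arg_one]

theorem GenPos.two_pi_mul_isect {l p : List ℂ} (h : GenPos (l ++ p)) {A B C D : ℂ}
    (hA : A ∈ l) (hB : B ∈ l) (hC : C ∈ p) (hD : D ∈ p) :
    2 * Real.pi * isect (A, B) (C, D) =
      oangle D A B - oangle C A B + (oangle A C D - oangle B C D) := by
  have hne : ∀ a ∈ l, ∀ b ∈ p, a ≠ b := (List.pairwise_append.mp h.1).2.2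
  have mA : A ∈ l ++ p := List.mem_append_left _ hA
  have mB : B ∈ l ++ p := List.mem_append_left _ hB
  have mC : C ∈ l ++ p := List.mem_append_right _ hC
  have mD : D ∈ l ++ p := List.mem_append_right _ hD
  have nAC := hne A hA C hC
  have nAD := hne A hA D hD
  have nBC := hne B hB C hC
  have nBD := hne B hB D hD
  by_cases hAB : A = B
  · subst hAB
    have : ¬(segment ℝ A A ∩ segment ℝ C D).Nonempty := by
      rintro ⟨x, hx, hx'⟩
      rw [segment_same, Set.mem_singleton_iff] at hx
      subst hx
      by_cases hCD : C = D
      · subst hCD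
        rw [segment_same] at hx'
        exact nAC hx'
      · exact h.cross_ne_zero mC mD mA hCD nAC.symm nAD.symm (cross_eq_zero_of_mem_segment hx')
    rw [isect, if_neg this, oangle_self nAC, oangle_self nAD]
    ring
  by_cases hCD : C = D
  · subst hCD
    have : ¬(segment ℝ A B ∩ segment ℝ C C).Nonempty := by
      rintro ⟨x, hx, hx'⟩
      rw [segment_same, Set.mem_singleton_iff] at hx'
      subst hx'
      exact h.cross_ne_zero mA mB mC hAB nAC nBC (cross_eq_zero_of_mem_segment hx)
    rw [isect, if_neg this, oangle_self nAC.symm, oangle_self nBC.symm]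
    ring
  exact _root_.two_pi_mul_isect (h.cross_ne_zero mA mB mC hAB nAC nBC)
    (h.cross_ne_zero mA mB mD hAB nAD nBD) (h.cross_ne_zero mC mD mA hCD nAC.symm nAD.symm)
    (h.cross_ne_zero mC mD mB hCD nBC.symm nBD.symm)

theorem cyc_mem {l : List ℂ} {e : ℂ × ℂ} (h : e ∈ cyc l) : e.1 ∈ l ∧ e.2 ∈ l := by
  obtain ⟨h₁, h₂⟩ := List.of_mem_zip (show (e.1, e.2) ∈ l.zip (l.rotate 1) from h)
  exact ⟨h₁, List.mem_rotate.mp h₂⟩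

theorem sum_map_sub_list {α : Type*} (L : List α) (f g : α → ℝ) :
    (L.map (fun e => f e - g e)).sum = (L.map f).sum - (L.map g).sum := by
  induction L with
  | nil => simp
  | cons a L ih =>
    simp only [List.map_cons, List.sum_cons, ih]
    ring

theorem cyc_sum_sub (l : List ℂ) (φ : ℂ → ℝ) :
    ((cyc l).map (fun e => φ e.1 - φ e.2)).sum = 0 := by
  have h₁ : ((cyc l).map (fun e => φ e.1)).sum = (l.map φ).sum := by
    have : (cyc l).map (fun e => φ e.1) = ((cyc l).map Prod.fst).map φ := by simp
    rw [this, cyc, List.map_fst_zip (by simp)]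
  have h₂ : ((cyc l).map (fun e => φ e.2)).sum = (l.map φ).sum := by
    have : (cyc l).map (fun e => φ e.2) = ((cyc l).map Prod.snd).map φ := by simp
    rw [this, cyc, List.map_snd_zip (by simp)]
    exact ((List.rotate_perm l 1).map φ).sum_eq
  rw [sum_map_sub_list, h₁, h₂, sub_self]

theorem GenPos.wind_sub_wind {l p : List ℂ} (h : GenPos (l ++ p)) {C D : ℂ}
    (hC : C ∈ p) (hD : D ∈ p) :
    wind l D - wind l C = ((cyc l).map (fun e => isect e (C, D))).sum := by
  have key : ((cyc l).map (fun e => 2 * Real.pi * isect e (C, D))).sum =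
      ((cyc l).map (fun e => oangle D e.1 e.2 - oangle C e.1 e.2 +
        (oangle e.1 C D - oangle e.2 C D))).sum := by
    congr 1
    refine List.map_congr_left fun e he => ?_
    exact h.two_pi_mul_isect (cyc_mem he).1 (cyc_mem he).2 hC hD
  rw [List.sum_map_mul_left, List.sum_map_add, cyc_sum_sub l (fun x => oangle x C D),
    sum_map_sub_list, add_zero] at key
  have hpi := Real.pi_ne_zero
  rw [wind, wind]
  field_simp
  linarith

theorem signedSum_cons (L P : List (ℂ × ℂ)) (f : ℂ × ℂ) :
    signedSum L (f :: P) = (L.map (fun e => isect e f)).sum + signedSum L P := by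
  simp [signedSum, List.sum_map_add]

theorem signedSum_eq_wind_sub_wind {l : List ℂ} (q p : List ℂ) (C P₁ : ℂ)
    (h : GenPos (l ++ q)) (hp : ∀ x ∈ C :: p, x ∈ q) (hp1 : (C :: p).getLast? = some P₁) :
    signedSum (cyc l) (opairs (C :: p)) = wind l P₁ - wind l C := by
  induction p generalizing C with
  | nil =>
    simp at hp1
    subst hp1
    simp [signedSum, opairs]
  | cons D p ih =>
    have : opairs (C :: D :: p) = (C, D) :: opairs (D :: p) := rfl
    rw [this, signedSum_cons, ← h.wind_sub_wind (hp C (by simp)) (hp D (by simp)),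
      ih D (fun x hx => hp x (List.mem_cons_of_mem _ hx)) (by simpa using hp1)]
    ring

theorem wind_eq_zero_of_notMem_convexHull {l : List ℂ} {O : ℂ}
    (h : O ∉ convexHull ℝ {x : ℂ | x ∈ l}) : wind l O = 0 := by
  have hcl : IsClosed (convexHull ℝ {x : ℂ | x ∈ l}) :=
    (l.finite_toSet.isCompact_convexHull ℝ).isClosed
  obtain ⟨f, u, hu, hf⟩ := geometric_hahn_banach_point_closed (convex_convexHull ℝ _) hcl h
  set c : ℂ := ⟨f 1, -f Complex.I⟩ with hc
  have hre : ∀ z : ℂ, (c * z).re = f z := by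
    intro z
    have : z = z.re • (1 : ℂ) + z.im • Complex.I := by
      apply Complex.ext <;> simp
    conv_rhs => rw [this]
    rw [map_add, map_smul, map_smul]
    simp [hc]
    ring
  have hpos : ∀ x ∈ l, 0 < (c * (x - O)).re := by
    intro x hx
    rw [hre, map_sub]
    linarith [hf x (subset_convexHull ℝ _ hx)]
  have hang : ∀ e ∈ cyc l, oangle O e.1 e.2 =
      -Complex.arg (c * (e.1 - O)) - -Complex.arg (c * (e.2 - O)) := by
    intro e he
    have p₁ := hpos _ (cyc_mem he).1
    have p₂ := hpos _ (cyc_mem he).2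
    have n₁ : c * (e.1 - O) ≠ 0 := by
      intro h0
      simp [h0] at p₁
    have n₂ : c * (e.2 - O) ≠ 0 := by
      intro h0
      simp [h0] at p₂
    have b₁ := abs_lt.mp (Complex.abs_arg_lt_pi_div_two_iff.mpr (Or.inl p₁))
    have b₂ := abs_lt.mp (Complex.abs_arg_lt_pi_div_two_iff.mpr (Or.inl p₂))
    have a₁ := Complex.neg_pi_lt_arg ((e.2 - O) / (e.1 - O))
    have a₂ := Complex.arg_le_pi ((e.2 - O) / (e.1 - O))
    rw [oangle]
    refine eq_of_coe_eq_of_abs_sub_lt ?_ (by linarith) (by linarith)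
    rw [← mul_div_mul_left _ _ (left_ne_zero_of_mul n₁), Complex.arg_div_coe_angle n₂ n₁]
    simp only [Real.Angle.coe_sub, Real.Angle.coe_neg]
    abel
  rw [wind, List.map_congr_left hang, cyc_sum_sub l (fun x => -Complex.arg (c * (x - O))),
    zero_div]

theorem stmt16 (l p : List ℂ) (hl : l ≠ []) (hp : p ≠ [])
    (P₀ P₁ : ℂ) (hp0 : p.head? = some P₀) (hp1 : p.getLast? = some P₁)
    (h : GenPos (l ++ p))
    (hP₀ : P₀ ∉ convexHull ℝ {x : ℂ | x ∈ l}) :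
    wind l P₁ = signedSum (cyc l) (opairs p) := by
  obtain ⟨q, rfl⟩ := List.head?_eq_some_iff.mp hp0
  rw [signedSum_eq_wind_sub_wind _ q P₀ P₁ h (fun _ hx => hx) hp1,
    wind_eq_zero_of_notMem_convexHull hP₀, sub_zero]
end

section
/- Let l be an open polygonal line from a point A to a point B and let p be an open polygonal line from a point C to a point D, such that the union of the edges of l is disjoint from the union of the edges of p. Then ∂(l × p) := w'(l, D) − w'(p, B) − w'(l, C) + w'(p, A) is well defined and equals 0. -/
/-- The quantity `w'` for an open polygonal line: the sum of the oriented angles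
`∠A_j O A_{j+1}` over consecutive vertices, divided by `2π`. -/
noncomputable def wind' (l : List ℂ) (O : ℂ) : ℝ :=
  ((opairs l).map (fun e => oangle O e.1 e.2)).sum / (2 * Real.pi)

lemma opairs_cons_cons (a b : ℂ) (t : List ℂ) :
    opairs (a :: b :: t) = (a, b) :: opairs (b :: t) := rfl

lemma exists_mem_opairs_fst_eq {l : List ℂ} (hl : 2 ≤ l.length) {A : ℂ} (hA : l.head? = some A) :
    ∃ e ∈ opairs l, e.1 = A := by
  match l, hl, hA with
  | a :: b :: t, _, hA => exact ⟨(a, b), by simp [opairs_cons_cons], by simpa using hA⟩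

lemma exists_mem_opairs_snd_eq {l : List ℂ} (hl : 2 ≤ l.length) {B : ℂ}
    (hB : l.getLast? = some B) : ∃ e ∈ opairs l, e.2 = B := by
  induction l with
  | nil => simp at hl
  | cons a t ih =>
    match t, hl, hB, ih with
    | [b], _, hB, _ => exact ⟨(a, b), by simp [opairs_cons_cons], by simpa using hB⟩
    | b :: c :: s, _, hB, ih =>
      obtain ⟨e, he, h⟩ := ih (by simp) (by simpa [List.getLast?_cons_cons] using hB)
      exact ⟨e, by rw [opairs_cons_cons]; exact List.mem_cons_of_mem _ he, h⟩

/-- The ratio defining the angle `∠AOB` lies in the slit plane when `O` is not on `[A, B]`. -/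
lemma div_mem_slitPlane_of_notMem_segment {O A B : ℂ} (h : O ∉ segment ℝ A B) :
    (B - O) / (A - O) ∈ Complex.slitPlane := by
  have hAO : A - O ≠ 0 := fun h0 => h (by
    rw [sub_eq_zero] at h0
    exact h0 ▸ left_mem_segment ℝ A B)
  rw [Complex.mem_slitPlane_iff_not_le_zero]
  intro hle
  obtain ⟨r, hr, hrz⟩ : ∃ r : ℝ, 0 ≤ r ∧ (B - O) / (A - O) = -(r : ℂ) := by
    rw [Complex.le_def] at hle
    refine ⟨-((B - O) / (A - O)).re, by simpa using hle.1, ?_⟩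
    apply Complex.ext
    · simp
    · simpa using hle.2
  rw [div_eq_iff hAO] at hrz
  apply h
  have h1 : (0 : ℝ) < 1 + r := by linarith
  refine ⟨r / (1 + r), 1 / (1 + r), by positivity, by positivity, by field_simp; ring, ?_⟩
  have h2 : (1 + r : ℂ) ≠ 0 := by exact_mod_cast h1.ne'
  simp only [Complex.real_smul]
  push_cast
  field_simp
  linear_combination hrz

lemma continuousOn_oangle {s : Set ℝ} {O A B : ℝ → ℂ} (hO : Continuous O) (hA : Continuous A)
    (hB : Continuous B) (h : ∀ t ∈ s, O t ∉ segment ℝ (A t) (B t)) :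
    ContinuousOn (fun t => oangle (O t) (A t) (B t)) s := by
  intro t ht
  have hne : A t - O t ≠ 0 := fun h0 => h t ht (by
    rw [sub_eq_zero] at h0
    exact h0 ▸ left_mem_segment ℝ (A t) (B t))
  have hq : ContinuousAt (fun t => (B t - O t) / (A t - O t)) t :=
    (hB.sub hO).continuousAt.div (hA.sub hO).continuousAt hne
  exact (ContinuousAt.comp (f := fun t => (B t - O t) / (A t - O t)) (Complex.continuousAt_arg
    (div_mem_slitPlane_of_notMem_segment (h t ht))) hq).continuousWithinAt

/-- For pairwise distinct endpoints, the boundary of a product of two segments vanishes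
modulo `2π`. -/
lemma coe_angle_boundary_eq_zero {A B C D : ℂ} (hAC : A ≠ C) (hAD : A ≠ D) (hBC : B ≠ C)
    (hBD : B ≠ D) :
    ((oangle D A B - oangle B C D - oangle C A B + oangle A C D : ℝ) : Real.Angle) = 0 := by
  have hAC' := sub_ne_zero.2 hAC
  have hAD' := sub_ne_zero.2 hAD
  have hBC' := sub_ne_zero.2 hBC
  have hBD' := sub_ne_zero.2 hBD
  have hCA' := sub_ne_zero.2 hAC.symm
  have hDA' := sub_ne_zero.2 hAD.symm
  have hCB' := sub_ne_zero.2 hBC.symm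
  have hDB' := sub_ne_zero.2 hBD.symm
  simp only [oangle, Real.Angle.coe_add, Real.Angle.coe_sub]
  rw [Complex.arg_div_coe_angle hBD' hAD', Complex.arg_div_coe_angle hDB' hCB',
    Complex.arg_div_coe_angle hBC' hAC', Complex.arg_div_coe_angle hDA' hCA',
    ← neg_sub D B, ← neg_sub A D, ← neg_sub C B, ← neg_sub A C,
    Complex.arg_neg_coe_angle hDB', Complex.arg_neg_coe_angle hAD',
    Complex.arg_neg_coe_angle hCB', Complex.arg_neg_coe_angle hAC']
  abel

/-- The boundary of a product of two disjoint segments vanishes. -/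
lemma oangle_boundary_eq_zero {A B C D : ℂ} (h : Disjoint (segment ℝ A B) (segment ℝ C D)) :
    oangle D A B - oangle B C D - oangle C A B + oangle A C D = 0 := by
  rw [Set.disjoint_left] at h
  let E : ℝ → ℂ := fun t => C + t • (D - C)
  have hE : Continuous E := by fun_prop
  have hE0 : E 0 = C := by simp [E]
  have hE1 : E 1 = D := by simp [E]
  have hmem : ∀ t ∈ Set.Icc (0 : ℝ) 1, E t ∈ segment ℝ C D := fun t ht => by
    rw [segment_eq_image']
    exact ⟨t, ht, rfl⟩
  have hC := left_mem_segment ℝ C D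
  have hA := left_mem_segment ℝ A B
  have hB := right_mem_segment ℝ A B
  have hsub : ∀ t ∈ Set.Icc (0 : ℝ) 1, segment ℝ C (E t) ⊆ segment ℝ C D := fun t ht =>
    (convex_segment C D).segment_subset hC (hmem t ht)
  let F : ℝ → ℝ := fun t => oangle (E t) A B - oangle B C (E t) - oangle C A B + oangle A C (E t)
  have hF : ContinuousOn F (Set.Icc 0 1) := by
    refine ((ContinuousOn.sub ?_ ?_).sub continuousOn_const).add ?_
    · exact continuousOn_oangle hE continuous_const continuous_const
        fun t ht hm => h hm (hmem t ht)
    · exact continuousOn_oangle continuous_const continuous_const hE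
        fun t ht hm => h hB (hsub t ht hm)
    · exact continuousOn_oangle continuous_const continuous_const hE
        fun t ht hm => h hA (hsub t ht hm)
  have hmaps : Set.MapsTo F (Set.Icc 0 1) (AddSubgroup.zmultiples (2 * Real.pi) : Set ℝ) := by
    intro t ht
    have hne : ∀ {x y : ℂ}, x ∈ segment ℝ A B → y ∈ segment ℝ C D → x ≠ y :=
      fun hx hy hxy => h hx (hxy ▸ hy)
    exact (QuotientAddGroup.eq_zero_iff _).1 (coe_angle_boundary_eq_zero (hne hA hC)
      (hne hA (hmem t ht)) (hne hB hC) (hne hB (hmem t ht)))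
  have hdiscrete : IsDiscrete (AddSubgroup.zmultiples (2 * Real.pi) : Set ℝ) :=
    ⟨inferInstanceAs (DiscreteTopology (AddSubgroup.zmultiples (2 * Real.pi)))⟩
  have hconst : F 1 = F 0 := isPreconnected_Icc.constant_of_mapsTo hdiscrete hF hmaps
    (Set.right_mem_Icc.2 zero_le_one) (Set.left_mem_Icc.2 zero_le_one)
  have hself : ∀ {O : ℂ}, C ≠ O → oangle O C C = 0 := fun hO => by
    rw [oangle, div_self (sub_ne_zero.2 hO), Complex.arg_one]
  have hCA : C ≠ A := fun he => h hA (he ▸ hC)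
  have hCB : C ≠ B := fun he => h hB (he ▸ hC)
  simpa [F, hE0, hE1, hself hCA, hself hCB] using hconst

/-- The total angle swept by a polygonal line, seen from `O`. -/
noncomputable def sweep (l : List ℂ) (O : ℂ) : ℝ :=
  ((opairs l).map (fun e => oangle O e.1 e.2)).sum

lemma sweep_singleton (a O : ℂ) : sweep [a] O = 0 := by simp [sweep, opairs]

lemma sweep_cons_cons (a b : ℂ) (t : List ℂ) (O : ℂ) :
    sweep (a :: b :: t) O = oangle O a b + sweep (b :: t) O := by
  simp [sweep, opairs_cons_cons]

lemma oangle_sweep_boundary_eq_zero {A B D : ℂ} (t : List ℂ) (C : ℂ)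
    (hD : (C :: t).getLast? = some D)
    (h : ∀ f ∈ opairs (C :: t), Disjoint (segment ℝ A B) (segment ℝ f.1 f.2)) :
    oangle D A B - sweep (C :: t) B - oangle C A B + sweep (C :: t) A = 0 := by
  induction t generalizing C with
  | nil =>
    obtain rfl : C = D := by simpa using hD
    simp [sweep_singleton]
  | cons c t ih =>
    simp only [opairs_cons_cons, List.forall_mem_cons] at h
    have h1 := oangle_boundary_eq_zero h.1
    have h2 := ih c (by simpa [List.getLast?_cons_cons] using hD) h.2
    rw [sweep_cons_cons, sweep_cons_cons]
    linarith

lemma sweep_boundary_eq_zero {B C D : ℂ} (s t : List ℂ) (A : ℂ)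
    (hB : (A :: s).getLast? = some B) (hD : (C :: t).getLast? = some D)
    (h : ∀ e ∈ opairs (A :: s), ∀ f ∈ opairs (C :: t),
      Disjoint (segment ℝ e.1 e.2) (segment ℝ f.1 f.2)) :
    sweep (A :: s) D - sweep (C :: t) B - sweep (A :: s) C + sweep (C :: t) A = 0 := by
  induction s generalizing A with
  | nil =>
    obtain rfl : A = B := by simpa using hB
    simp [sweep_singleton]
  | cons a s ih =>
    simp only [opairs_cons_cons A, List.forall_mem_cons] at h
    have h1 := oangle_sweep_boundary_eq_zero t C hD h.1
    have h2 := ih a (by simpa [List.getLast?_cons_cons] using hB) h.2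
    rw [sweep_cons_cons A, sweep_cons_cons A]
    linarith

theorem stmt17 (l p : List ℂ) (hl : 2 ≤ l.length) (hp : 2 ≤ p.length)
    (A B C D : ℂ)
    (hA : l.head? = some A) (hB : l.getLast? = some B)
    (hC : p.head? = some C) (hD : p.getLast? = some D)
    (hdisj : Disjoint (⋃ e ∈ opairs l, segment ℝ e.1 e.2)
      (⋃ f ∈ opairs p, segment ℝ f.1 f.2)) :
    (∀ e ∈ opairs l, C ∉ segment ℝ e.1 e.2 ∧ D ∉ segment ℝ e.1 e.2) ∧
    (∀ f ∈ opairs p, A ∉ segment ℝ f.1 f.2 ∧ B ∉ segment ℝ f.1 f.2) ∧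
    wind' l D - wind' p B - wind' l C + wind' p A = 0 := by
  have hdisj' : ∀ e ∈ opairs l, ∀ f ∈ opairs p,
      Disjoint (segment ℝ e.1 e.2) (segment ℝ f.1 f.2) := by
    simp only [Set.disjoint_iUnion_left, Set.disjoint_iUnion_right] at hdisj
    exact fun e he f hf => hdisj f hf e he
  refine ⟨fun e he => ⟨fun hm => ?_, fun hm => ?_⟩, fun f hf => ⟨fun hm => ?_, fun hm => ?_⟩, ?_⟩
  · obtain ⟨f, hf, rfl⟩ := exists_mem_opairs_fst_eq hp hC
    exact Set.disjoint_left.1 (hdisj' e he f hf) hm (left_mem_segment ℝ _ _)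
  · obtain ⟨f, hf, rfl⟩ := exists_mem_opairs_snd_eq hp hD
    exact Set.disjoint_left.1 (hdisj' e he f hf) hm (right_mem_segment ℝ _ _)
  · obtain ⟨e, he, rfl⟩ := exists_mem_opairs_fst_eq hl hA
    exact Set.disjoint_left.1 (hdisj' e he f hf) (left_mem_segment ℝ _ _) hm
  · obtain ⟨e, he, rfl⟩ := exists_mem_opairs_snd_eq hl hB
    exact Set.disjoint_left.1 (hdisj' e he f hf) (right_mem_segment ℝ _ _) hm
  · obtain ⟨s, rfl⟩ := List.head?_eq_some_iff.1 hA
    obtain ⟨t, rfl⟩ := List.head?_eq_some_iff.1 hC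
    have h := sweep_boundary_eq_zero s t A hB hD hdisj'
    change sweep _ D / _ - sweep _ B / _ - sweep _ C / _ + sweep _ A / _ = 0
    rw [← sub_div, ← sub_div, ← add_div, h, zero_div]
end
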